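/- For every square matrix M ∈ ℝ^{d×d} and every T > 0, there exists a nonnegative function ρ ∈ C_c^∞(ℝ^d) with ∫ρ = 1 such that ∫_{ℝ^d} |div_y(M y ρ(y))| dy ≤ 2/T. Consequently, the infimum of ∫|div_y(M y ρ(y))| dy over all nonnegative ρ ∈ C_c^∞(ℝ^d) with ∫ρ = 1 equals 0. -/

import Mathlib

open MeasureTheory Real

noncomputable section

/-- Divergence of a vector field on `ℝ^d`, `div v x = trace (Dv(x)) = ∑ i ∂_i v_i (x)`. -/
def eucDiv {d : ℕ} (v : EuclideanSpace ℝ (Fin d) → EuclideanSpace ℝ (Fin d))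
    (x : EuclideanSpace ℝ (Fin d)) : ℝ :=
  LinearMap.trace ℝ (EuclideanSpace ℝ (Fin d)) (fderiv ℝ v x)

lemma aux_det_deriv {n : ℕ} (V : ℝ → Matrix (Fin n) (Fin n) ℝ) (V' : Matrix (Fin n) (Fin n) ℝ)
    (h0 : V 0 = 1) (hV : ∀ i j, HasDerivAt (fun t => V t i j) (V' i j) 0) :
    HasDerivAt (fun t => (V t).det) V'.trace 0 := by
  simp only [Matrix.det_apply]
  have h : HasDerivAt (fun t => ∑ σ : Equiv.Perm (Fin n), Equiv.Perm.sign σ • ∏ i, V t (σ i) i)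
      (∑ σ : Equiv.Perm (Fin n), Equiv.Perm.sign σ •
        ∑ i, (∏ j ∈ Finset.univ.erase i, V 0 (σ j) j) • V' (σ i) i) 0 := by
    refine HasDerivAt.fun_sum fun σ _ => ?_
    have := HasDerivAt.fun_finsetProd (u := Finset.univ) (fun i _ => hV (σ i) i)
    exact this.const_smul ((Equiv.Perm.sign σ : ℤˣ) : ℤ)
  convert h using 1
  rw [Finset.sum_eq_single 1]
  · simp only [Equiv.Perm.sign_one, one_smul, Equiv.Perm.one_apply, h0, Matrix.one_apply_eq,
      Finset.prod_const_one, Matrix.trace, Matrix.diag]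
  · intro σ _ hσ
    rw [Finset.sum_eq_zero, smul_zero]
    intro i _
    obtain ⟨k, hk⟩ : ∃ k, σ k ≠ k := by
      by_contra! hc
      exact hσ (Equiv.ext hc)
    obtain ⟨j, hji, hj⟩ : ∃ j, j ≠ i ∧ σ j ≠ j := by
      by_cases hki : k = i
      · refine ⟨σ k, hki ▸ hk, fun h => hk (σ.injective h)⟩
      · exact ⟨k, hki, hk⟩
    rw [Finset.prod_eq_zero (Finset.mem_erase.2 ⟨hji, Finset.mem_univ j⟩), zero_smul]
    rw [h0, Matrix.one_apply_ne hj]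
  · simp

section helpers

variable {d : ℕ}
local notation "E" => EuclideanSpace ℝ (Fin d)

def flowU (A : E →L[ℝ] E) (t : ℝ) : E →L[ℝ] E := NormedSpace.exp (t • A)

lemma flowU_zero (A : E →L[ℝ] E) : flowU A 0 = 1 := by
  have h : (0:ℝ) • A = 0 := zero_smul ℝ A
  rw [flowU, h, NormedSpace.exp_zero]

lemma flowU_add (A : E →L[ℝ] E) (s t : ℝ) : flowU A (s + t) = flowU A s * flowU A t := by
  have h : (s + t) • A = s • A + t • A := add_smul s t A
  rw [flowU, h]
  let _ : NormedAlgebra ℚ (E →L[ℝ] E) := NormedAlgebra.restrictScalars ℚ ℝ _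
  refine NormedSpace.exp_add_of_commute ?_
  show (s • A) * (t • A) = (t • A) * (s • A)
  apply ContinuousLinearMap.ext
  intro x
  show s • A (t • A x) = t • A (s • A x)
  rw [map_smul, map_smul, smul_comm]

lemma flowU_add_apply (A : E →L[ℝ] E) (s t : ℝ) (y : E) :
    flowU A (s + t) y = flowU A s (flowU A t y) := by
  rw [flowU_add]; rfl

lemma flowU_deriv (A : E →L[ℝ] E) (t : ℝ) : HasDerivAt (flowU A) (flowU A t * A) t :=
  hasDerivAt_exp_smul_const A t

lemma flowU_contDiff (A : E →L[ℝ] E) : ContDiff ℝ (⊤ : ℕ∞) (flowU A) := by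
  have h : ContDiff ℝ (⊤ : ℕ∞) (NormedSpace.exp : (E →L[ℝ] E) → (E →L[ℝ] E)) :=
    contDiff_iff_contDiffAt.2 fun x => (NormedSpace.exp_analytic (𝕂 := ℝ) x).contDiffAt
  exact h.comp (contDiff_id.smul contDiff_const)

lemma flowU_det (A : E →L[ℝ] E) (t : ℝ) :
    LinearMap.det (flowU A t : E →ₗ[ℝ] E) = Real.exp (t * LinearMap.trace ℝ E A) := by
  set τ := LinearMap.trace ℝ E A
  set D : ℝ → ℝ := fun t => LinearMap.det (flowU A t : E →ₗ[ℝ] E) with hD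
  have hmul : ∀ s t, D (s + t) = D s * D t := by
    intro s t
    simp only [hD, flowU_add]
    rw [← LinearMap.det_comp]; rfl
  have hD0 : D 0 = 1 := by
    simp only [hD, flowU_zero]
    exact LinearMap.det_id
  have hd0 : HasDerivAt D τ 0 := by
    let b := (EuclideanSpace.basisFun (Fin d) ℝ).toBasis
    have hDm : D = fun t => (LinearMap.toMatrix b b (flowU A t : E →ₗ[ℝ] E)).det := by
      funext t; simp only [hD, LinearMap.det_toMatrix]
    have hτ : τ = (LinearMap.toMatrix b b (A : E →ₗ[ℝ] E)).trace :=
      LinearMap.trace_eq_matrix_trace ℝ b _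
    rw [hDm, hτ]
    refine aux_det_deriv _ _ ?_ ?_
    · rw [flowU_zero]; exact LinearMap.toMatrix_one b
    · intro i j
      let L : (E →L[ℝ] E) →L[ℝ] ℝ := (EuclideanSpace.proj i).comp
        (ContinuousLinearMap.apply ℝ E (b j))
      have := L.hasFDerivAt.comp_hasDerivAt 0 (flowU_deriv A 0)
      rw [flowU_zero, one_mul] at this
      have hL : ∀ B : E →L[ℝ] E, LinearMap.toMatrix b b (B : E →ₗ[ℝ] E) i j = L B := by
        intro B; simp [L, b, LinearMap.toMatrix_apply]
      simp only [hL]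
      exact this
  have hd : ∀ t, HasDerivAt D (D t * τ) t := by
    intro t
    have h1 : HasDerivAt (fun s => D t * D (s - t)) (D t * τ) t := by
      have h2 : HasDerivAt D τ (t - t) := by simpa using hd0
      exact (h2.comp_sub_const t t).const_mul _
    have h3 : D = fun s => D t * D (s - t) := by
      funext s
      rw [← hmul, add_sub_cancel]
    rw [h3]
    simpa only [sub_self, hD0, mul_one] using h1
  have hc : ∀ t, HasDerivAt (fun t => D t * Real.exp (-(t * τ))) 0 t := by
    intro t
    have h2 : HasDerivAt (fun t => Real.exp (-(t * τ))) (Real.exp (-(t * τ)) * -(1 * τ)) t :=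
      (((hasDerivAt_id t).mul_const τ).neg).exp
    have h3 := (hd t).mul h2
    have h4 : D t * τ * Real.exp (-(t * τ)) + D t * (Real.exp (-(t * τ)) * -(1 * τ)) = 0 := by ring
    rw [h4] at h3
    exact h3
  have := is_const_of_deriv_eq_zero (fun t => (hc t).differentiableAt) (fun t => (hc t).deriv) t 0
  simp only [hD0, zero_mul, neg_zero, Real.exp_zero, mul_one] at this
  rw [Real.exp_neg] at this
  have he := Real.exp_pos (t * τ)
  show D t = _
  field_simp at this
  exact this

lemma aux_integral_comp (B : E →L[ℝ] E) (hB : LinearMap.det (B : E →ₗ[ℝ] E) ≠ 0) (f : E → ℝ) (hf : Continuous f) :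
    ∫ y, f (B y) = |(LinearMap.det (B : E →ₗ[ℝ] E))⁻¹| * ∫ y, f y := by
  have h := Measure.map_linearMap_addHaar_eq_smul_addHaar (volume : Measure E) hB
  have h2 : ∫ y, f y ∂(Measure.map B volume) = ∫ y, f (B y) :=
    integral_map B.continuous.aemeasurable hf.aestronglyMeasurable
  rw [← h2]
  erw [h]
  rw [integral_smul_measure, ENNReal.toReal_ofReal (abs_nonneg _), smul_eq_mul]

open scoped Convolution in
lemma aux_smooth (F : ℝ → E → ℝ) (hF : ContDiff ℝ (⊤ : ℕ∞) (fun q : ℝ × E => F q.1 q.2)) (T : ℝ) (hT : 0 < T) :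
    ContDiff ℝ (⊤ : ℕ∞) (fun y => ∫ t in (0:ℝ)..T, F t y) := by
  let χ : ContDiffBump (0 : ℝ) := ⟨T, T + 1, hT, by linarith⟩
  let g : E → ℝ → ℝ := fun p x => χ x * F (-x) p
  let f : ℝ → ℝ := Set.indicator (Set.Ioc 0 T) (fun _ => 1)
  have hg : ContDiff ℝ (⊤ : ℕ∞) (fun q : E × ℝ => g q.1 q.2) := by
    have h1 : ContDiff ℝ (⊤ : ℕ∞) (fun q : E × ℝ => χ q.2) := χ.contDiff.comp contDiff_snd
    have h2 : ContDiff ℝ (⊤ : ℕ∞) (fun q : E × ℝ => F (-q.2) q.1) :=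
      hF.comp (contDiff_snd.neg.prodMk contDiff_fst)
    exact h1.mul h2
  have hf : LocallyIntegrable f volume := by
    apply Integrable.locallyIntegrable
    rw [integrable_indicator_iff measurableSet_Ioc]
    exact integrableOn_const (by simp)
  have hs : ∀ p : E, ∀ x : ℝ, p ∈ Set.univ → x ∉ tsupport χ → g p x = 0 := by
    intro p x _ hx
    simp only [g, image_eq_zero_of_notMem_tsupport hx, zero_mul]
  have key := contDiffOn_convolution_right_with_param_comp (n := ⊤) (μ := volume) (ContinuousLinearMap.mul ℝ ℝ)
    (v := fun _ : E => (0:ℝ)) contDiffOn_const (f := f) (g := g) isOpen_univ χ.hasCompactSupport hs hf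
    hg.contDiffOn
  rw [contDiffOn_univ] at key
  convert key using 1
  funext y
  rw [intervalIntegral.integral_of_le hT.le, ← integral_indicator measurableSet_Ioc]
  simp only [convolution]
  congr 1
  funext t
  by_cases ht : t ∈ Set.Ioc 0 T
  · have : χ (-t) = 1 := χ.one_of_mem_closedBall (by
      simp [χ, abs_of_pos ht.1, ht.2])
    simp [f, g, ht, this]
  · simp [f, ht]

def dens (A : E →L[ℝ] E) (r : E → ℝ) (t : ℝ) (y : E) : ℝ :=
  Real.exp (-t * LinearMap.trace ℝ E A) * r (flowU A (-t) y)

lemma dens_smooth (A : E →L[ℝ] E) (r : E → ℝ) (hr : ContDiff ℝ (⊤ : ℕ∞) r) :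
    ContDiff ℝ (⊤ : ℕ∞) (fun q : ℝ × E => dens A r q.1 q.2) := by
  have h1 : ContDiff ℝ (⊤ : ℕ∞) (fun q : ℝ × E => flowU A (-q.1)) :=
    (flowU_contDiff A).comp contDiff_fst.neg
  have h2 : ContDiff ℝ (⊤ : ℕ∞) (fun q : ℝ × E => flowU A (-q.1) q.2) := h1.clm_apply contDiff_snd
  have h3 : ContDiff ℝ (⊤ : ℕ∞) (fun q : ℝ × E => Real.exp (-q.1 * LinearMap.trace ℝ E A)) :=
    (contDiff_fst.neg.mul contDiff_const).exp
  exact h3.mul (hr.comp h2)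

lemma dens_integral (A : E →L[ℝ] E) (r : E → ℝ) (hr : Continuous r) (hi : ∫ y, r y = 1) (t : ℝ) :
    ∫ y, dens A r t y = 1 := by
  simp only [dens]
  rw [integral_const_mul, aux_integral_comp (flowU A (-t)) (by rw [flowU_det]; positivity) r hr,
    flowU_det, hi, mul_one, abs_of_pos (by positivity)]
  exact mul_inv_cancel₀ (Real.exp_pos _).ne'

lemma flowU_cancel (A : E →L[ℝ] E) (t : ℝ) (y : E) : flowU A t (flowU A (-t) y) = y := by
  rw [← flowU_add_apply, add_neg_cancel, flowU_zero]; rfl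

lemma eucDiv_smul (A : E →L[ℝ] E) (ρ : E → ℝ) (y : E) (hρ : DifferentiableAt ℝ ρ y) :
    LinearMap.trace ℝ E (fderiv ℝ (fun y => ρ y • A y) y : E →L[ℝ] E)
      = ρ y * LinearMap.trace ℝ E A + fderiv ℝ ρ y (A y) := by
  have h : HasFDerivAt (fun y => ρ y • A y) (ρ y • A + (fderiv ℝ ρ y).smulRight (A y)) y :=
    hρ.hasFDerivAt.smul A.hasFDerivAt
  rw [h.fderiv]
  have h2 : ((ρ y • A + (fderiv ℝ ρ y).smulRight (A y) : E →L[ℝ] E) : E →ₗ[ℝ] E)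
    = ρ y • (A : E →ₗ[ℝ] E) + ((fderiv ℝ ρ y : E →L[ℝ] ℝ) : E →ₗ[ℝ] ℝ).smulRight (A y) := rfl
  rw [h2, map_add, map_smul, smul_eq_mul, LinearMap.trace_smulRight]
  rfl

lemma dens_flow (A : E →L[ℝ] E) (r : E → ℝ) (s t : ℝ) (y : E) :
    dens A r t (flowU A s y) = Real.exp (-s * LinearMap.trace ℝ E A) * dens A r (t - s) y := by
  simp only [dens]
  rw [← flowU_add_apply, ← mul_assoc, ← Real.exp_add]
  congr 3 <;> ring_nf

lemma main_div (A : E →L[ℝ] E) (r : E → ℝ) (hr : ContDiff ℝ (⊤ : ℕ∞) r) (T : ℝ) (y : E)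
    (ρ : E → ℝ) (hρ : Differentiable ℝ ρ)
    (hdef : ∀ y, ρ y = T⁻¹ * ∫ t in (0:ℝ)..T, dens A r t y) :
    LinearMap.trace ℝ E (fderiv ℝ (fun y => ρ y • A y) y : E →L[ℝ] E)
      = T⁻¹ * (r y - dens A r T y) := by
  rw [eucDiv_smul A ρ y (hρ y)]
  set τ := LinearMap.trace ℝ E A with hτ
  have hc : Continuous fun t => dens A r t y :=
    (dens_smooth A r hr).continuous.comp (continuous_id.prodMk continuous_const)
  -- chain rule
  have h1 : HasDerivAt (fun s => ρ (flowU A s y)) (fderiv ℝ ρ y (A y)) 0 := by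
    have hf : HasDerivAt (fun s => flowU A s y) (A y) 0 := by
      have := ((ContinuousLinearMap.apply ℝ E y).hasFDerivAt.comp_hasDerivAt 0 (flowU_deriv A 0))
      rw [flowU_zero, one_mul] at this
      exact this
    have h0 : flowU A 0 y = y := by rw [flowU_zero]; rfl
    have := (hρ (flowU A 0 y)).hasFDerivAt.comp_hasDerivAt 0 hf
    rw [h0] at this
    exact this
  have h2 : (fun s => ρ (flowU A s y)) =
      fun s => T⁻¹ * (Real.exp (-s * τ) * ((∫ t in (0:ℝ)..(T - s), dens A r t y) -
        ∫ t in (0:ℝ)..(0 - s), dens A r t y)) := by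
    funext s
    rw [hdef]
    simp only [dens_flow]
    rw [intervalIntegral.integral_const_mul,
      intervalIntegral.integral_comp_sub_right (fun t => dens A r t y) s,
      ← intervalIntegral.integral_interval_sub_left (a := 0) (hc.intervalIntegrable _ _)
        (hc.intervalIntegrable _ _)]
  have hI : ∀ u : ℝ, HasDerivAt (fun s => ∫ t in (0:ℝ)..(u - s), dens A r t y)
      (-dens A r u y) 0 := by
    intro u
    have h := intervalIntegral.integral_hasDerivAt_right (hc.intervalIntegrable 0 (u - 0))
      (hc.stronglyMeasurableAtFilter _ _) hc.continuousAt
    have h' := h.comp_const_sub u 0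
    simpa using h'
  have hE : HasDerivAt (fun s => Real.exp (-s * τ)) (-τ) 0 := by
    have := (((hasDerivAt_id (0:ℝ)).neg).mul_const τ).exp
    simpa using this
  have h3 := (hE.mul ((hI T).sub (hI 0))).const_mul T⁻¹
  rw [h2] at h1
  have h4 := h1.unique h3
  rw [h4, hdef y]
  have h5 : dens A r 0 y = r y := by simp [dens, flowU_zero]
  simp [h5]
  ring

lemma main_exists (A : E →L[ℝ] E) (T : ℝ) (hT : 0 < T) : ∃ ρ : E → ℝ,
      ContDiff ℝ (⊤ : ℕ∞) ρ ∧ HasCompactSupport ρ ∧ (∀ y, 0 ≤ ρ y) ∧ ((∫ y, ρ y) = 1) ∧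
      (∫ y, |LinearMap.trace ℝ E (fderiv ℝ (fun y => ρ y • A y) y : E →L[ℝ] E)|) ≤ 2 / T := by
  let φ : ContDiffBump (0 : E) := ⟨1, 2, one_pos, one_lt_two⟩
  obtain ⟨r, hr, hrs, hr0, hri⟩ : ∃ r : E → ℝ, ContDiff ℝ (⊤ : ℕ∞) r ∧ HasCompactSupport r ∧
      (∀ y, 0 ≤ r y) ∧ ∫ y, r y = 1 :=
    ⟨φ.normed volume, φ.contDiff_normed, φ.hasCompactSupport_normed, φ.nonneg_normed,
      φ.integral_normed⟩
  have hsm := dens_smooth A r hr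
  have hd0 : ∀ t y, 0 ≤ dens A r t y := fun t y => mul_nonneg (Real.exp_pos _).le (hr0 _)
  have hdi := dens_integral A r hr.continuous hri
  have hdI : ∀ t, Integrable (dens A r t) := fun t => by
    by_contra h
    have := hdi t
    rw [integral_undef h] at this
    exact zero_ne_one this
  have hρs := contDiff_const (c := T⁻¹).mul (aux_smooth (dens A r) hsm T hT)
  refine ⟨fun y => T⁻¹ * ∫ t in (0:ℝ)..T, dens A r t y, hρs, ?_, ?_, ?_, ?_⟩
  · have hK : IsCompact ((fun q : ℝ × E => flowU A q.1 q.2) '' (Set.Icc 0 T ×ˢ tsupport r)) := by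
      refine (isCompact_Icc.prod hrs).image ?_
      exact ((flowU_contDiff A).continuous.comp continuous_fst).clm_apply continuous_snd
    refine HasCompactSupport.intro hK fun y hy => ?_
    rw [intervalIntegral.integral_of_le hT.le, setIntegral_eq_zero_of_forall_eq_zero, mul_zero]
    intro t ht
    have : flowU A (-t) y ∉ tsupport r := fun h =>
      hy ⟨(t, flowU A (-t) y), ⟨⟨ht.1.le, ht.2⟩, h⟩, flowU_cancel A t y⟩
    simp only [dens, image_eq_zero_of_notMem_tsupport this, mul_zero]
  · intro y
    exact mul_nonneg (by positivity) (intervalIntegral.integral_nonneg hT.le fun t _ => hd0 t y)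
  · rw [integral_const_mul]
    simp only [intervalIntegral.integral_of_le hT.le]
    rw [integral_integral_swap]
    · simp only [hdi]
      simp [hT.le, hT.ne']
    · suffices h : Integrable (fun q : ℝ × E => dens A r q.1 q.2)
          ((volume.restrict (Set.Ioc 0 T)).prod volume) from h.swap
      rw [integrable_prod_iff hsm.continuous.aestronglyMeasurable]
      refine ⟨Filter.Eventually.of_forall fun t => hdI t, ?_⟩
      simp only [Real.norm_of_nonneg (hd0 _ _), hdi]
      exact integrable_const _
  · have hrI : Integrable r := hr.continuous.integrable_of_hasCompactSupport hrs
    have hb : ∀ y, |LinearMap.trace ℝ E (fderiv ℝ (fun y =>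
        (T⁻¹ * ∫ t in (0:ℝ)..T, dens A r t y) • A y) y : E →L[ℝ] E)|
        ≤ T⁻¹ * (r y + dens A r T y) := by
      intro y
      rw [main_div A r hr T y (fun y => T⁻¹ * ∫ t in (0:ℝ)..T, dens A r t y)
        (hρs.differentiable (by simp)) (fun _ => rfl), abs_mul, abs_of_pos (inv_pos.2 hT)]
      refine mul_le_mul_of_nonneg_left ?_ (inv_pos.2 hT).le
      rw [abs_le]
      constructor <;> linarith [hr0 y, hd0 T y]
    refine (integral_mono_of_nonneg (Filter.Eventually.of_forall fun y => abs_nonneg _)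
      ((hrI.add (hdI T)).const_mul T⁻¹) (Filter.Eventually.of_forall hb)).trans ?_
    have : ∫ y, T⁻¹ * (r y + dens A r T y) = 2 / T := by
      rw [integral_const_mul, integral_add hrI (hdI T), hri, hdi]
      ring
    exact this.le

end helpers

/-- for every square matrix `M` and every `T > 0` there is a nonnegative
`ρ ∈ C_c^∞(ℝ^d)` with `∫ ρ = 1` and `∫ |div_y (M y ρ(y))| dy ≤ 2 / T`; consequently the
infimum of this quantity over all admissible `ρ` is `0`. -/
theorem stmt0 {d : ℕ} (M : Matrix (Fin d) (Fin d) ℝ) :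
    (∀ T : ℝ, 0 < T → ∃ ρ : EuclideanSpace ℝ (Fin d) → ℝ,
      ContDiff ℝ (⊤ : ℕ∞) ρ ∧ HasCompactSupport ρ ∧ (∀ y, 0 ≤ ρ y) ∧ ((∫ y, ρ y) = 1) ∧
      (∫ y, |eucDiv (fun y => ρ y • (Matrix.toEuclideanCLM (𝕜 := ℝ) M) y) y|) ≤ 2 / T) ∧
    sInf {r : ℝ | ∃ ρ : EuclideanSpace ℝ (Fin d) → ℝ,
      ContDiff ℝ (⊤ : ℕ∞) ρ ∧ HasCompactSupport ρ ∧ (∀ y, 0 ≤ ρ y) ∧ ((∫ y, ρ y) = 1) ∧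
      r = ∫ y, |eucDiv (fun y => ρ y • (Matrix.toEuclideanCLM (𝕜 := ℝ) M) y) y|} = 0 := by
  have hex := main_exists (Matrix.toEuclideanCLM (𝕜 := ℝ) M)
  refine ⟨hex, le_antisymm ?_ ?_⟩
  · refine le_of_forall_pos_le_add fun ε hε => ?_
    obtain ⟨ρ, h1, h2, h3, h4, h5⟩ := hex (2 / ε) (by positivity)
    rw [zero_add]
    have h6 : 2 / (2 / ε) = ε := by field_simp
    rw [h6] at h5
    refine le_trans (csInf_le ?_ ⟨ρ, h1, h2, h3, h4, rfl⟩) h5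
    · refine ⟨0, ?_⟩
      rintro _ ⟨ρ, _, _, _, _, rfl⟩
      exact integral_nonneg fun y => abs_nonneg _
  · refine Real.sInf_nonneg ?_
    rintro _ ⟨ρ, _, _, _, _, rfl⟩
    exact integral_nonneg fun y => abs_nonneg _

end
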